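/- As n → ∞, 𝔼(Π̂(n)^2) = n^2/M_n^2 + 2n^2/M_n^3 + O(n^2/M_n^4); consequently Var(Π̂(n)) = O(n^2/M_n^4). -/

import Mathlib

open MeasureTheory Filter Finset Asymptotics
open scoped Classical

/-- `y_m(α) = ∏_{j ∈ α, j < m} (1 - 1/j)` (empty product = 1). -/
noncomputable def hawkinsY (A : Set ℕ) (m : ℕ) : ℝ :=
  ∏ j ∈ Finset.range m, if j ∈ A then 1 - 1 / (j : ℝ) else 1

/-- The σ-algebra generated by the events `{j ∈ α}` for `2 ≤ j < m`. -/
def sieveSigma {Ω : Type*} (α : Ω → Set ℕ) (m : ℕ) : MeasurableSpace Ω :=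
  MeasurableSpace.generateFrom {s | ∃ j : ℕ, 2 ≤ j ∧ j < m ∧ s = {ω | j ∈ α ω}}

/-- Wunderlich's model of the Hawkins random sieve: a probability space `(Ω, μ)` with a
random subset `α` of `{2,3,4,…}` such that `μ(2 ∈ α) = 1` and, for every `m ≥ 2`, the
conditional probability of `{m ∈ α}` given the σ-algebra generated by the events
`{j ∈ α}`, `2 ≤ j < m`, equals `y_m(α)`. -/
structure IsHawkinsSieve {Ω : Type*} [MeasurableSpace Ω] (μ : Measure Ω)
    (α : Ω → Set ℕ) : Prop where
  isProb : IsProbabilityMeasure μ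
  meas : ∀ n : ℕ, MeasurableSet {ω | n ∈ α ω}
  mem_ge_two : ∀ ω, ∀ n ∈ α ω, 2 ≤ n
  two_mem : μ {ω | 2 ∈ α ω} = 1
  condExp_mem : ∀ m : ℕ, 2 ≤ m →
    μ[Set.indicator {ω | m ∈ α ω} (fun _ => (1 : ℝ)) | sieveSigma α m]
      =ᵐ[μ] fun ω => hawkinsY (α ω) m

/-- `M_k = 1 + ∑_{j=1}^{k-2} 1/j` (so `M_2 = 1`). -/
noncomputable def Mharm (k : ℕ) : ℝ := 1 + ∑ j ∈ Finset.Icc 1 (k - 2), 1 / (j : ℝ)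

/-- `Π̂(x; α) = Σ_{m ≤ x, m ∈ α, m+2 ∈ α} (y_m(α) - (1/(m+1))(1 - 1/m) y_m(α)^2)⁻¹`. -/
noncomputable def piHat (A : Set ℕ) (x : ℕ) : ℝ :=
  ∑ m ∈ Finset.range (x + 1),
    if m ∈ A ∧ m + 2 ∈ A then
      (hawkinsY A m - (1 / ((m : ℝ) + 1)) * (1 - 1 / (m : ℝ)) * (hawkinsY A m) ^ 2)⁻¹
    else 0

/-- `f` depends only on the elements of its argument below `m`. -/
def DependsBelow (m : ℕ) (f : Set ℕ → ℝ) : Prop :=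
  ∀ A B : Set ℕ, (∀ j < m, j ∈ A ↔ j ∈ B) → f A = f B

lemma DependsBelow.mono {m n : ℕ} {f : Set ℕ → ℝ} (hf : DependsBelow m f) (hmn : m ≤ n) :
    DependsBelow n f :=
  fun A B hAB => hf A B fun j hj => hAB j (hj.trans_le hmn)

lemma DependsBelow.comp {m : ℕ} {f : Set ℕ → ℝ} (hf : DependsBelow m f) (φ : ℝ → ℝ) :
    DependsBelow m fun A => φ (f A) :=
  fun A B hAB => congrArg φ (hf A B hAB)

lemma DependsBelow.comp₂ {m : ℕ} {f g : Set ℕ → ℝ} (hf : DependsBelow m f)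
    (hg : DependsBelow m g) (φ : ℝ → ℝ → ℝ) : DependsBelow m fun A => φ (f A) (g A) :=
  fun A B hAB => congrArg₂ φ (hf A B hAB) (hg A B hAB)

lemma DependsBelow.sum {m : ℕ} {ι : Type*} (s : Finset ι) {f : ι → Set ℕ → ℝ}
    (hf : ∀ i ∈ s, DependsBelow m (f i)) : DependsBelow m fun A => ∑ i ∈ s, f i A :=
  fun A B hAB => Finset.sum_congr rfl fun i hi => hf i hi A B hAB

lemma dependsBelow_indicator {m j : ℕ} (hj : j < m) :
    DependsBelow m fun A => if j ∈ A then 1 else 0 :=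
  fun A B hAB => by simp only [hAB j hj]

lemma dependsBelow_hawkinsY (m : ℕ) : DependsBelow m fun A => hawkinsY A m :=
  fun A B hAB => Finset.prod_congr rfl fun j hj => by simp only [hAB j (Finset.mem_range.1 hj)]

lemma DependsBelow.exists_filter {m : ℕ} {f : Set ℕ → ℝ} (hf : DependsBelow m f) (A : Set ℕ) :
    f A = f ((Finset.range m).filter (· ∈ A) : Finset ℕ) :=
  hf _ _ fun j hj => by simp [hj]

section Integration

variable {Ω : Type*} [MeasurableSpace Ω] {μ : Measure Ω} {α : Ω → Set ℕ}

lemma IsHawkinsSieve.sieveSigma_le (h : IsHawkinsSieve μ α) (m : ℕ) :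
    sieveSigma α m ≤ ‹MeasurableSpace Ω› := by
  refine MeasurableSpace.generateFrom_le ?_
  rintro s ⟨j, -, -, rfl⟩
  exact h.meas j

lemma IsHawkinsSieve.measurable_dependsBelow (h : IsHawkinsSieve μ α) {m : ℕ} {f : Set ℕ → ℝ}
    (hf : DependsBelow m f) : Measurable[sieveSigma α m] fun ω => f (α ω) := by
  have hmem : ∀ j < m, MeasurableSet[sieveSigma α m] {ω | j ∈ α ω} := by
    intro j hj
    by_cases h2 : 2 ≤ j
    · exact MeasurableSpace.measurableSet_generateFrom ⟨j, h2, hj, rfl⟩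
    · have : {ω | j ∈ α ω} = ∅ := by
        ext ω
        simpa using fun hω => h2 (h.mem_ge_two ω j hω)
      rw [this]
      exact @MeasurableSet.empty _ (sieveSigma α m)
  let : MeasurableSpace (Finset ℕ) := ⊤
  have hF : Measurable[sieveSigma α m] fun ω => (Finset.range m).filter (· ∈ α ω) := by
    refine @measurable_to_countable' _ _ _ _ (sieveSigma α m) _ fun S => ?_
    have : (fun ω => (Finset.range m).filter (· ∈ α ω)) ⁻¹' {S}
        = ⋂ j : ℕ, {ω | (j < m ∧ j ∈ α ω) ↔ j ∈ S} := by
      ext ω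
      simp [Finset.ext_iff]
    rw [this]
    refine @MeasurableSet.iInter _ _ (sieveSigma α m) _ _ fun j => ?_
    by_cases hj : j < m <;> by_cases hS : j ∈ S
    · simpa [hj, hS] using hmem j hj
    · convert @MeasurableSet.compl _ _ (sieveSigma α m) (hmem j hj) using 1
      ext ω
      simp [hj, hS]
    · simp [hj, hS]
    · simp [hj, hS]
  have : (fun ω => f (α ω)) = (fun S : Finset ℕ => f (S : Set ℕ)) ∘
      fun ω => (Finset.range m).filter (· ∈ α ω) := by
    ext ω
    exact hf.exists_filter (α ω)
  rw [this]
  exact Measurable.comp measurable_from_top hF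

lemma DependsBelow.exists_bound {m : ℕ} {f : Set ℕ → ℝ} (hf : DependsBelow m f) :
    ∃ C : ℝ, ∀ A, ‖f A‖ ≤ C := by
  refine ⟨∑ S ∈ (Finset.range m).powerset, ‖f (S : Set ℕ)‖, fun A => ?_⟩
  rw [hf.exists_filter A]
  exact Finset.single_le_sum (f := fun S : Finset ℕ => ‖f (S : Set ℕ)‖)
    (fun _ _ => norm_nonneg _) (Finset.mem_powerset.2 (Finset.filter_subset _ _))

lemma IsHawkinsSieve.integrable (h : IsHawkinsSieve μ α) {m : ℕ} {f : Set ℕ → ℝ}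
    (hf : DependsBelow m f) : Integrable (fun ω => f (α ω)) μ := by
  have := h.isProb
  obtain ⟨C, hC⟩ := hf.exists_bound
  exact Integrable.of_bound
    ((h.measurable_dependsBelow hf).mono (h.sieveSigma_le m) le_rfl).aestronglyMeasurable C
    (Eventually.of_forall fun ω => hC _)

lemma IsHawkinsSieve.integral_mul_indicator (h : IsHawkinsSieve μ α) {m : ℕ} (hm : 2 ≤ m)
    {f : Set ℕ → ℝ} (hf : DependsBelow m f) :
    ∫ ω, f (α ω) * (if m ∈ α ω then 1 else 0) ∂μ = ∫ ω, f (α ω) * hawkinsY (α ω) m ∂μ := by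
  have := h.isProb
  have hle := h.sieveSigma_le m
  have hind : (fun ω => if m ∈ α ω then (1 : ℝ) else 0)
      = Set.indicator {ω | m ∈ α ω} (fun _ => (1 : ℝ)) := by
    ext ω
    simp [Set.indicator_apply]
  have hi1 : Integrable (fun ω => f (α ω) * (if m ∈ α ω then (1 : ℝ) else 0)) μ :=
    h.integrable (m := m + 1)
      ((hf.mono m.le_succ).comp₂ (dependsBelow_indicator m.lt_succ_self) (· * ·))
  have hi2 : Integrable (fun ω => if m ∈ α ω then (1 : ℝ) else 0) μ :=
    h.integrable (m := m + 1) (dependsBelow_indicator m.lt_succ_self)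
  rw [← integral_condExp hle]
  refine integral_congr_ae ?_
  have h1 := condExp_mul_of_stronglyMeasurable_left (μ := μ) (m := sieveSigma α m)
    (h.measurable_dependsBelow hf).stronglyMeasurable hi1 hi2
  refine h1.trans ?_
  rw [hind]
  filter_upwards [h.condExp_mem m hm] with ω hω
  simp [hω]

lemma IsHawkinsSieve.integral_ite (h : IsHawkinsSieve μ α) {m : ℕ} (hm : 2 ≤ m)
    {f g : Set ℕ → ℝ} (hf : DependsBelow m f) (hg : DependsBelow m g) :
    ∫ ω, (if m ∈ α ω then f (α ω) else g (α ω)) ∂μ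
      = ∫ ω, (hawkinsY (α ω) m * f (α ω) + (1 - hawkinsY (α ω) m) * g (α ω)) ∂μ := by
  have hfg : DependsBelow m fun A => f A - g A := hf.comp₂ hg (· - ·)
  have hy := dependsBelow_hawkinsY m
  have h1 := h.integral_mul_indicator hm hfg
  have e1 : ∀ ω, (if m ∈ α ω then f (α ω) else g (α ω))
      = (f (α ω) - g (α ω)) * (if m ∈ α ω then 1 else 0) + g (α ω) := by
    intro ω
    split_ifs <;> ring
  have e2 : ∀ ω, hawkinsY (α ω) m * f (α ω) + (1 - hawkinsY (α ω) m) * g (α ω)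
      = (f (α ω) - g (α ω)) * hawkinsY (α ω) m + g (α ω) := by
    intro ω
    ring
  simp_rw [e1, e2]
  rw [integral_add _ (h.integrable hg), integral_add _ (h.integrable hg), h1]
  · exact h.integrable (hfg.comp₂ hy (· * ·))
  · exact h.integrable (m := m + 1)
      ((hfg.mono m.le_succ).comp₂ (dependsBelow_indicator m.lt_succ_self) (· * ·))

end Integration

section Pointwise

variable {A : Set ℕ}

lemma hawkinsY_succ (A : Set ℕ) (m : ℕ) :
    hawkinsY A (m + 1) = hawkinsY A m * if m ∈ A then 1 - 1 / (m : ℝ) else 1 :=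
  Finset.prod_range_succ _ _

lemma hawkinsY_pos (hA : ∀ n ∈ A, 2 ≤ n) (m : ℕ) : 0 < hawkinsY A m := by
  refine Finset.prod_pos fun j _ => ?_
  split_ifs with hj
  · have : (2 : ℝ) ≤ j := by exact_mod_cast hA j hj
    rw [sub_pos, div_lt_one (by linarith)]
    linarith
  · exact one_pos

lemma hawkinsY_le_one (hA : ∀ n ∈ A, 2 ≤ n) (m : ℕ) : hawkinsY A m ≤ 1 := by
  induction m with
  | zero => simp [hawkinsY]
  | succ m ih =>
    rw [hawkinsY_succ]
    refine mul_le_one₀ ih ?_ ?_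
    · split_ifs with hj
      · have : (2 : ℝ) ≤ m := by exact_mod_cast hA m hj
        rw [sub_nonneg, div_le_one (by linarith)]
        linarith
      · exact zero_le_one
    · split_ifs
      · have : (0 : ℝ) ≤ 1 / m := by positivity
        linarith
      · exact le_rfl

lemma hawkinsY_two (hA : ∀ n ∈ A, 2 ≤ n) : hawkinsY A 2 = 1 := by
  have h0 : 0 ∉ A := fun h => absurd (hA 0 h) (by norm_num)
  have h1 : 1 ∉ A := fun h => absurd (hA 1 h) (by norm_num)
  simp [hawkinsY, Finset.prod_range_succ, h0, h1]

lemma one_le_mul_hawkinsY (hA : ∀ n ∈ A, 2 ≤ n) {m : ℕ} (hm : 2 ≤ m) :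
    1 ≤ ((m : ℝ) - 1) * hawkinsY A m := by
  induction m, hm using Nat.le_induction with
  | base => rw [hawkinsY_two hA]; norm_num
  | succ m hm ih =>
    have hm' : (2 : ℝ) ≤ m := by exact_mod_cast hm
    have hy := hawkinsY_pos hA m
    rw [hawkinsY_succ]
    push_cast
    split_ifs
    · have : ((m : ℝ) + 1 - 1) * (hawkinsY A m * (1 - 1 / m)) = (m - 1) * hawkinsY A m := by
        field_simp
        ring
      linarith
    · nlinarith

lemma Mharm_succ {m : ℕ} (hm : 2 ≤ m) : Mharm (m + 1) = Mharm m + 1 / ((m : ℝ) - 1) := by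
  obtain ⟨k, rfl⟩ := Nat.exists_eq_add_of_le' hm
  simp only [Mharm]
  rw [show k + 2 + 1 - 2 = k + 1 by lia, show k + 2 - 2 = k by lia,
    Finset.sum_Icc_succ_top (by lia)]
  push_cast
  ring

lemma one_le_Mharm (m : ℕ) : 1 ≤ Mharm m := by
  have : 0 ≤ ∑ j ∈ Finset.Icc 1 (m - 2), 1 / (j : ℝ) :=
    Finset.sum_nonneg fun _ _ => by positivity
  unfold Mharm
  linarith

/-- The deviation of `1 / y_m` from its mean `M_m`. -/
noncomputable def invDev (A : Set ℕ) (m : ℕ) : ℝ := (hawkinsY A m)⁻¹ - Mharm m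

lemma dependsBelow_invDev (m : ℕ) : DependsBelow m fun A => invDev A m :=
  (dependsBelow_hawkinsY m).comp fun y => y⁻¹ - Mharm m

lemma invDev_succ (hA : ∀ n ∈ A, 2 ≤ n) {m : ℕ} (hm : 2 ≤ m) :
    invDev A (m + 1) = if m ∈ A then
      invDev A m + 1 / ((m : ℝ) - 1) * ((hawkinsY A m)⁻¹ - 1)
      else invDev A m - 1 / ((m : ℝ) - 1) := by
  have hm' : (2 : ℝ) ≤ m := by exact_mod_cast hm
  have hy := (hawkinsY_pos hA m).ne'
  have : (m : ℝ) - 1 ≠ 0 := by linarith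
  simp only [invDev, hawkinsY_succ, Mharm_succ hm]
  split_ifs
  · have h3 : 1 - 1 / (m : ℝ) = (m - 1) / m := by field_simp
    rw [h3]
    field_simp
    ring
  · ring

lemma fourth_moment_step {y z d x M : ℝ} (hyz : y * z = 1) (hz : 1 ≤ z) (hx : 0 ≤ x)
    (hxz : x * z ≤ 1) (hM : 1 ≤ M) (hd : d = z - M) :
    y * (d + x * (z - 1)) ^ 4 + (1 - y) * (d - x) ^ 4
      ≤ d ^ 4 + 20 * (x ^ 2 * M) * (1 + d ^ 4) := by
  have e : y * (d + x * (z - 1)) ^ 4 + (1 - y) * (d - x) ^ 4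
      = d ^ 4 + 6 * d ^ 2 * x ^ 2 * (z - 1) + 4 * d * x ^ 3 * ((z - 1) * (z - 2))
        + x ^ 4 * ((z - 1) * (z ^ 2 - 3 * z + 3)) := by
    linear_combination (4*d^3*x + 6*d^2*x^2*(z-2) + 4*d*x^3*(z^2-3*z+3) +
      x^4*(z^3-4*z^2+6*z-4)) * hyz
  rw [e]
  have hz0 : 0 ≤ z - 1 := by linarith
  have b1 : 6 * d ^ 2 * x ^ 2 * (z - 1) ≤ (x ^ 2 * z) * (6 * d ^ 2) := by
    nlinarith [mul_nonneg (sq_nonneg d) (sq_nonneg x)]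
  have b2 : 4 * d * x ^ 3 * ((z - 1) * (z - 2)) ≤ (x ^ 2 * z) * (4 * |d|) := by
    have h1 : |x * ((z - 1) * (z - 2))| ≤ z := by
      rw [abs_mul, abs_mul, abs_of_nonneg hx, abs_of_nonneg hz0]
      have : |z - 2| ≤ z := abs_le.2 ⟨by linarith, by linarith⟩
      have h3 : (z - 1) * |z - 2| ≤ z * z := by gcongr; linarith
      nlinarith [mul_le_mul_of_nonneg_left h3 hx]
    have h2 : d * (x * ((z - 1) * (z - 2))) ≤ |d| * z := by
      refine (le_abs_self _).trans ?_
      rw [abs_mul]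
      gcongr
    nlinarith [mul_le_mul_of_nonneg_left h2 (sq_nonneg x)]
  have b3 : x ^ 4 * ((z - 1) * (z ^ 2 - 3 * z + 3)) ≤ x ^ 2 * z := by
    have h1 : (z - 1) * (z ^ 2 - 3 * z + 3) ≤ z ^ 3 := by nlinarith
    have h2 : x ^ 2 * z ^ 3 ≤ z := by
      have : (x * z) ^ 2 ≤ 1 := pow_le_one₀ (by positivity) hxz
      nlinarith
    have := mul_le_mul_of_nonneg_left h1 (by positivity : 0 ≤ x ^ 4)
    nlinarith [mul_le_mul_of_nonneg_left h2 (sq_nonneg x)]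
  have hd4 : |d| ^ 4 = d ^ 4 := by rw [← abs_pow]; exact abs_of_nonneg (by positivity)
  have hd2 : |d| ^ 2 = d ^ 2 := sq_abs d
  have b4 : z * (6 * d ^ 2 + 4 * |d| + 1) ≤ 20 * M * (1 + d ^ 4) := by
    have hzd : z ≤ M * (1 + |d|) := by
      have := le_abs_self d
      nlinarith [abs_nonneg d]
    have h0 : 0 ≤ 6 * d ^ 2 + 4 * |d| + 1 := by positivity
    have h1 : (1 + |d|) * (6 * d ^ 2 + 4 * |d| + 1) ≤ 20 * (1 + d ^ 4) := by
      rw [← hd4, ← hd2]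
      generalize |d| = t
      nlinarith [sq_nonneg (t ^ 2 - t), sq_nonneg (t - 1), sq_nonneg (t ^ 2 - 1), sq_nonneg t]
    calc _ ≤ M * (1 + |d|) * (6 * d ^ 2 + 4 * |d| + 1) := by gcongr
      _ = M * ((1 + |d|) * (6 * d ^ 2 + 4 * |d| + 1)) := by ring
      _ ≤ M * (20 * (1 + d ^ 4)) := by gcongr
      _ = _ := by ring
  have := mul_le_mul_of_nonneg_left b4 (sq_nonneg x)
  linarith

end Pointwise

section Moments

variable {Ω : Type*} [MeasurableSpace Ω] {μ : Measure Ω} {α : Ω → Set ℕ}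

lemma IsHawkinsSieve.integral_invDev (h : IsHawkinsSieve μ α) {m : ℕ} (hm : 2 ≤ m) :
    ∫ ω, invDev (α ω) m ∂μ = 0 := by
  induction m, hm using Nat.le_induction with
  | base => simp [invDev, hawkinsY_two (h.mem_ge_two _), Mharm]
  | succ m hm ih =>
    have hd := dependsBelow_invDev m
    have hy := dependsBelow_hawkinsY m
    simp_rw [invDev_succ (h.mem_ge_two _) hm]
    rw [h.integral_ite hm
      (f := fun A => invDev A m + 1 / ((m : ℝ) - 1) * ((hawkinsY A m)⁻¹ - 1))
      (g := fun A => invDev A m - 1 / ((m : ℝ) - 1))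
      (hd.comp₂ hy fun d y => d + 1 / ((m : ℝ) - 1) * (y⁻¹ - 1))
      (hd.comp fun d => d - 1 / ((m : ℝ) - 1)), ← ih]
    refine integral_congr_ae (Eventually.of_forall fun ω => ?_)
    have := (hawkinsY_pos (h.mem_ge_two ω) m).ne'
    field_simp
    ring

lemma IsHawkinsSieve.integral_invDev_pow_four_succ_le (h : IsHawkinsSieve μ α) {m : ℕ}
    (hm : 2 ≤ m) :
    1 + ∫ ω, invDev (α ω) (m + 1) ^ 4 ∂μ
      ≤ (1 + 20 * (Mharm m / ((m : ℝ) - 1) ^ 2)) * (1 + ∫ ω, invDev (α ω) m ^ 4 ∂μ) := by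
  have := h.isProb
  have hd := dependsBelow_invDev m
  have hy := dependsBelow_hawkinsY m
  have hm' : (2 : ℝ) ≤ m := by exact_mod_cast hm
  have hk : 0 < (m : ℝ) - 1 := by linarith
  set x : ℝ := 1 / ((m : ℝ) - 1) with hx
  have hsucc : ∀ ω, invDev (α ω) (m + 1) ^ 4 = if m ∈ α ω then
      (invDev (α ω) m + x * ((hawkinsY (α ω) m)⁻¹ - 1)) ^ 4 else (invDev (α ω) m - x) ^ 4 := by
    intro ω
    rw [invDev_succ (h.mem_ge_two _) hm]
    split_ifs <;> rfl
  have hf : DependsBelow m fun A => (invDev A m + x * ((hawkinsY A m)⁻¹ - 1)) ^ 4 :=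
    hd.comp₂ hy fun d y => (d + x * (y⁻¹ - 1)) ^ 4
  have hg : DependsBelow m fun A => (invDev A m - x) ^ 4 := hd.comp fun d => (d - x) ^ 4
  have hi : Integrable (fun ω => invDev (α ω) m ^ 4) μ :=
    h.integrable (hd.comp fun d => d ^ 4)
  have hi' : Integrable (fun ω => 1 + invDev (α ω) m ^ 4) μ := (integrable_const _).add hi
  have hle : ∫ ω, invDev (α ω) (m + 1) ^ 4 ∂μ
      ≤ ∫ ω, (invDev (α ω) m ^ 4 + 20 * (x ^ 2 * Mharm m) * (1 + invDev (α ω) m ^ 4)) ∂μ := by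
    simp_rw [hsucc]
    rw [h.integral_ite hm hf hg]
    refine integral_mono (h.integrable ((hy.comp₂ hf (· * ·)).comp₂
      ((hy.comp (1 - ·)).comp₂ hg (· * ·)) (· + ·)))
      (hi.add (hi'.const_mul _)) fun ω => ?_
    have hA := h.mem_ge_two ω
    have hypos := hawkinsY_pos hA m
    refine fourth_moment_step (mul_inv_cancel₀ hypos.ne')
      ((one_le_inv₀ hypos).2 (hawkinsY_le_one hA m)) (by positivity) ?_ (one_le_Mharm m) rfl
    rw [hx, one_div, ← mul_inv]
    exact inv_le_one_of_one_le₀ (one_le_mul_hawkinsY hA hm)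
  rw [integral_add hi (hi'.const_mul _), integral_const_mul,
    integral_add (integrable_const _) hi] at hle
  simp only [integral_const, probReal_univ, smul_eq_mul, mul_one] at hle
  have : x ^ 2 * Mharm m = Mharm m / ((m : ℝ) - 1) ^ 2 := by
    rw [hx]
    field_simp
  rw [this] at hle
  linarith

end Moments

section Harmonic

lemma Mharm_le_log (m : ℕ) : Mharm m ≤ 2 + Real.log m := by
  have h := harmonic_le_one_add_log (m - 2)
  have h1 : Mharm m = 1 + (harmonic (m - 2) : ℝ) := by
    simp [Mharm, harmonic_eq_sum_Icc]
  have h2 : Real.log ((m - 2 : ℕ) : ℝ) ≤ Real.log m := by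
    rcases Nat.eq_zero_or_pos (m - 2) with h0 | h0
    · simpa [h0] using Real.log_natCast_nonneg m
    · exact Real.log_le_log (by exact_mod_cast h0) (by exact_mod_cast Nat.sub_le _ _)
  linarith

lemma tendsto_Mharm : Tendsto Mharm atTop atTop := by
  have h1 : ∀ m : ℕ, Mharm m = 1 + ∑ i ∈ Finset.range (m - 2), 1 / ((i : ℝ) + 1) := by
    intro m
    unfold Mharm
    congr 1
    induction m - 2 with
    | zero => simp
    | succ k ih =>
      rw [Finset.sum_Icc_succ_top (by lia), ih, Finset.sum_range_succ]
      push_cast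
      rfl
  have h2 := Real.tendsto_sum_range_one_div_nat_succ_atTop.comp (tendsto_sub_atTop_nat 2)
  exact (tendsto_atTop_add_const_left _ 1 h2).congr fun m => (h1 m).symm

lemma isLittleO_Mharm_pow (p : ℕ) :
    (fun m : ℕ => Mharm m ^ p) =o[atTop] fun m : ℕ => (m : ℝ) := by
  have hlog : Tendsto (fun m : ℕ => Real.log m) atTop atTop :=
    Real.tendsto_log_atTop.comp tendsto_natCast_atTop_atTop
  have h1 : Mharm =O[atTop] fun m : ℕ => Real.log m := by
    refine IsBigO.of_bound 3 ?_
    filter_upwards [hlog.eventually_ge_atTop 1] with m hm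
    rw [Real.norm_of_nonneg (by linarith [one_le_Mharm m]), Real.norm_of_nonneg (by linarith)]
    linarith [Mharm_le_log m]
  exact (h1.pow p).trans_isLittleO
    ((Real.isLittleO_pow_log_id_atTop (n := p)).comp_tendsto tendsto_natCast_atTop_atTop)

lemma isBigO_inv_nat_Mharm (p : ℕ) :
    (fun m : ℕ => 1 / (m : ℝ)) =O[atTop] fun m => 1 / Mharm m ^ p := by
  simp_rw [one_div]
  refine (isLittleO_Mharm_pow p).isBigO.inv_rev (Eventually.of_forall fun m hm => ?_)
  exact absurd hm (pow_pos (zero_lt_one.trans_le (one_le_Mharm m)) p).ne'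

lemma summable_Mharm_div_sq : Summable fun m : ℕ => Mharm m / ((m : ℝ) - 1) ^ 2 := by
  refine summable_of_isBigO_nat (Real.summable_nat_rpow_inv.2 (by norm_num : (1 : ℝ) < 3 / 2)) ?_
  have h1 : Mharm =O[atTop] fun m : ℕ => (m : ℝ) ^ (1 / 2 : ℝ) := by
    refine IsBigO.of_bound 1 ?_
    filter_upwards [(isLittleO_Mharm_pow 2).bound (zero_lt_one)] with m hm
    have h0 := one_le_Mharm m
    have hs : (0 : ℝ) ≤ (m : ℝ) ^ (1 / 2 : ℝ) := by positivity
    rw [Real.norm_of_nonneg (by positivity), Real.norm_of_nonneg (by positivity)] at hm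
    rw [Real.norm_of_nonneg (by linarith), Real.norm_of_nonneg hs, one_mul,
      ← Real.sqrt_eq_rpow]
    exact Real.le_sqrt_of_sq_le (by linarith)
  have h2 : (fun m : ℕ => (((m : ℝ) - 1) ^ 2)⁻¹) =O[atTop] fun m : ℕ => ((m : ℝ) ^ 2)⁻¹ := by
    refine IsBigO.of_bound 4 ?_
    filter_upwards [eventually_ge_atTop 2] with m hm
    have hm' : (2 : ℝ) ≤ m := by exact_mod_cast hm
    rw [Real.norm_of_nonneg (by positivity), Real.norm_of_nonneg (by positivity),
      ← div_eq_mul_inv, inv_eq_one_div, div_le_div_iff₀ (by nlinarith) (by positivity)]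
    nlinarith
  refine (h1.mul h2).congr' (Eventually.of_forall fun m => (div_eq_mul_inv _ _).symm) ?_
  filter_upwards [eventually_gt_atTop 0] with m hm
  have hm' : (0 : ℝ) < m := by exact_mod_cast hm
  rw [← Real.rpow_natCast, ← Real.rpow_neg hm'.le, ← Real.rpow_neg hm'.le, ← Real.rpow_add hm']
  norm_num

lemma tendsto_div_Mharm_pow (p : ℕ) :
    Tendsto (fun n : ℕ => (n : ℝ) / Mharm n ^ p) atTop atTop := by
  have h : Tendsto (fun n : ℕ => Mharm n ^ p / (n : ℝ)) atTop (nhdsWithin 0 (Set.Ioi 0)) := by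
    refine tendsto_nhdsWithin_iff.2 ⟨(isLittleO_Mharm_pow p).tendsto_div_nhds_zero, ?_⟩
    filter_upwards [eventually_gt_atTop 0] with n hn
    have : (0 : ℝ) < n := by exact_mod_cast hn
    exact div_pos (pow_pos (zero_lt_one.trans_le (one_le_Mharm n)) p) this
  exact h.inv_tendsto_nhdsGT_zero.congr fun n => inv_div _ _

lemma isBigO_sum_range_of_le_sub {f a : ℕ → ℝ} {C : ℝ} (ha : Tendsto a atTop atTop)
    (h : ∀ᶠ m in atTop, |f (m + 1)| ≤ C * (a (m + 1) - a m)) :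
    (fun n => ∑ m ∈ Finset.range (n + 1), f m) =O[atTop] a := by
  obtain ⟨N, hN⟩ := eventually_atTop.1 h
  set K : ℝ := |∑ m ∈ Finset.range (N + 1), f m| - C * a N with hK
  have key : ∀ n, N ≤ n → |∑ m ∈ Finset.range (n + 1), f m| ≤ K + C * a n := by
    intro n hn
    induction n, hn using Nat.le_induction with
    | base => simp [hK]
    | succ n hn ih =>
      rw [Finset.sum_range_succ]
      refine (abs_add_le _ _).trans ?_
      linarith [hN n hn]
  refine IsBigO.of_bound (|K| + |C|) ?_
  filter_upwards [eventually_ge_atTop N, ha.eventually_ge_atTop 1] with n hn han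
  rw [Real.norm_eq_abs, Real.norm_of_nonneg (by linarith)]
  have h1 := le_abs_self K
  have h2 := mul_le_mul_of_nonneg_right (le_abs_self C) (by linarith : 0 ≤ a n)
  nlinarith [key n hn, abs_nonneg K]

lemma Mharm_succ_le {m : ℕ} (hm : 2 ≤ m) : Mharm (m + 1) ≤ 2 * ((m : ℝ) - 1) := by
  induction m, hm using Nat.le_induction with
  | base => norm_num [Mharm]
  | succ m hm ih =>
    have hm' : (2 : ℝ) ≤ m := by exact_mod_cast hm
    rw [Mharm_succ (by lia)]
    push_cast
    have : 1 / ((m : ℝ) + 1 - 1) ≤ 1 := by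
      rw [div_le_one (by linarith)]
      linarith
    linarith

lemma inv_Mharm_pow_le_sub (p : ℕ) :
    ∀ᶠ m : ℕ in atTop, 1 / Mharm (m + 1) ^ p
      ≤ 2 * (((m + 1 : ℕ) : ℝ) / Mharm (m + 1) ^ p - (m : ℝ) / Mharm m ^ p) := by
  filter_upwards [eventually_ge_atTop 2,
    (tendsto_Mharm.comp (tendsto_add_atTop_nat 1)).eventually_ge_atTop (6 * p)] with m hm hMp
  have hm' : (2 : ℝ) ≤ m := by exact_mod_cast hm
  have hk : 0 < (m : ℝ) - 1 := by linarith
  have hM := one_le_Mharm m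
  have hM1 := one_le_Mharm (m + 1)
  have hs := Mharm_succ hm
  simp only [Function.comp_apply] at hMp
  set M := Mharm m
  set M' := Mharm (m + 1)
  have hM'0 : 0 < M' := by linarith
  have hM0 : 0 < M := by linarith
  set e : ℝ := 1 / ((m - 1) * M') with he
  have hratio : M / M' = 1 + -e := by
    rw [he]
    field_simp
    rw [hs]
    field_simp
    ring
  have he1 : e ≤ 1 := by
    rw [he, div_le_one (by positivity)]
    nlinarith
  have hbern := one_add_mul_le_pow (a := -e) (by linarith) p
  rw [← hratio, div_pow] at hbern
  have hpe : (m + 1 / 2 : ℝ) * (p * e) ≤ 1 / 2 := by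
    rw [he, ← mul_div_assoc, mul_one, ← mul_div_assoc, div_le_iff₀ (by positivity)]
    nlinarith
  have h1 : (m : ℝ) ≤ (m + 1 / 2) * (M ^ p / M' ^ p) := by
    have := mul_le_mul_of_nonneg_left hbern (by positivity : (0 : ℝ) ≤ m + 1 / 2)
    linarith
  have h2 : (m : ℝ) / M ^ p ≤ (m + 1 / 2) / M' ^ p := by
    rw [div_le_iff₀ (by positivity)]
    calc (m : ℝ) ≤ _ := h1
      _ = _ := by ring
  have h3 : ((m + 1 : ℕ) : ℝ) / M' ^ p = (m + 1 / 2) / M' ^ p + 1 / 2 * (1 / M' ^ p) := by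
    push_cast
    ring
  linarith

lemma isBigO_sum_range_Mharm {f : ℕ → ℝ} (p : ℕ)
    (hf : f =O[atTop] fun m => 1 / Mharm m ^ p) :
    (fun n => ∑ m ∈ Finset.range (n + 1), f m) =O[atTop] fun n => (n : ℝ) / Mharm n ^ p := by
  obtain ⟨C, hC0, hC⟩ := hf.exists_nonneg
  refine isBigO_sum_range_of_le_sub (C := C * 2) (tendsto_div_Mharm_pow p) ?_
  filter_upwards [(tendsto_add_atTop_nat 1).eventually hC.bound, inv_Mharm_pow_le_sub p]
    with m h1 h2
  have h0 : 0 ≤ 1 / Mharm (m + 1) ^ p := by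
    have := one_le_Mharm (m + 1)
    positivity
  rw [Real.norm_eq_abs, Real.norm_of_nonneg h0] at h1
  have := mul_le_mul_of_nonneg_left h2 hC0
  linarith

/-- The first two terms of the expansion of `∑_{m ≤ n} 1 / M_m`. -/
noncomputable def mainTerm (n : ℕ) : ℝ := n / Mharm n + n / Mharm n ^ 2

lemma isBigO_sum_inv_Mharm_sub_mainTerm :
    (fun n => ∑ m ∈ Finset.range (n + 1), 1 / Mharm m - mainTerm n)
      =O[atTop] fun n => (n : ℝ) / Mharm n ^ 3 := by
  let f : ℕ → ℝ := fun m => 1 / Mharm m - (mainTerm m - mainTerm (m - 1))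
  have hf : f =O[atTop] fun m => 1 / Mharm m ^ 3 := by
    refine IsBigO.of_bound 30 ?_
    filter_upwards [eventually_ge_atTop 3] with n hn
    obtain ⟨m, rfl⟩ : ∃ m, n = m + 1 := ⟨n - 1, by lia⟩
    have hm : 2 ≤ m := by lia
    have hm' : (2 : ℝ) ≤ m := by exact_mod_cast hm
    have hM := one_le_Mharm m
    have hM1 := one_le_Mharm (m + 1)
    have hs := Mharm_succ hm
    have hle := Mharm_succ_le hm
    simp only [f, mainTerm, Nat.add_sub_cancel]
    set M := Mharm m
    set M' := Mharm (m + 1)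
    have hM0 : 0 < M := by linarith
    have hM'0 : 0 < M' := by linarith
    push_cast
    have hm2 : (m : ℝ) = ((m : ℝ) - 1) + 1 := by ring
    generalize (m : ℝ) - 1 = k at *
    have hk : 0 < k := by linarith
    have hx : 1 / k = M' - M := by linarith
    have hx1 : 1 / k ≤ 1 := by rw [div_le_one hk]; linarith
    have hM'2 : M' ≤ 2 * M := by linarith
    have hu : 1 / M ≤ 2 * (1 / M') := by
      rw [← mul_div_assoc, div_le_div_iff₀ hM0 hM'0]
      linarith
    have hku : 1 / k ≤ 2 * (1 / M') := by
      rw [← mul_div_assoc, div_le_div_iff₀ hk hM'0]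
      linarith
    have hexp : 1 / M' - ((m + 1) / M' + (m + 1) / M' ^ 2 - (m / M + m / M ^ 2))
        = (1 / k) * (1 / M) * (1 / M') ^ 2 + (1 / k) * (1 / M) * (1 / M')
          + (1 + 1 / k) * ((M + M') * (1 / M) ^ 2 * (1 / M') ^ 2) := by
      rw [hm2]
      have : M' = M + 1 / k := by linarith
      have hne : k * M + 1 ≠ 0 := by positivity
      rw [this]
      field_simp
      ring
    have hnn : 0 ≤ 1 / M' := by positivity
    have hnn' : 0 ≤ 1 / M := by positivity
    have hkk : 0 ≤ 1 / k := by positivity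
    rw [hexp, Real.norm_of_nonneg (by positivity), Real.norm_of_nonneg (by positivity)]
    have hMu : (M + M') * (1 / M) ≤ 3 := by
      rw [mul_one_div, div_le_iff₀ hM0]
      linarith
    rw [← one_div_pow]
    calc (1 / k) * (1 / M) * (1 / M') ^ 2 + (1 / k) * (1 / M) * (1 / M')
          + (1 + 1 / k) * ((M + M') * (1 / M) ^ 2 * (1 / M') ^ 2)
        = (1 / k) * (1 / M) * (1 / M') ^ 2 + (1 / k) * (1 / M) * (1 / M')
          + (1 + 1 / k) * ((M + M') * (1 / M)) * (1 / M) * (1 / M') ^ 2 := by ring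
      _ ≤ 1 * (2 * (1 / M')) * (1 / M') ^ 2 + (2 * (1 / M')) * (2 * (1 / M')) * (1 / M')
          + (1 + 1) * 3 * (2 * (1 / M')) * (1 / M') ^ 2 := by gcongr
      _ ≤ 30 * (1 / M') ^ 3 := by nlinarith [pow_nonneg hnn 3]
  refine (isBigO_sum_range_Mharm 3 hf).congr_left fun n => ?_
  have htel : ∑ m ∈ Finset.range (n + 1), (mainTerm m - mainTerm (m - 1)) = mainTerm n := by
    induction n with
    | zero => simp [mainTerm]
    | succ n ih =>
      rw [Finset.sum_range_succ, ih]
      simp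
  rw [← htel, ← Finset.sum_sub_distrib]

end Harmonic

section Approximation

lemma abs_sub_inv_add_le {y M : ℝ} (hy : 0 < y) (hy1 : y ≤ 1) (hM : 1 ≤ M) :
    |y - 1 / M + (y⁻¹ - M) / M ^ 2| ≤ 2 * (1 + (y⁻¹ - M) ^ 4) / M ^ 3 := by
  have hM0 : 0 < M := by linarith
  obtain ⟨d, hd⟩ : ∃ d, d = y⁻¹ - M := ⟨_, rfl⟩
  rw [← hd]
  have hyd : y * d = 1 - M * y := by
    rw [hd, mul_sub, mul_inv_cancel₀ hy.ne']
    ring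
  have e : y - 1 / M + d / M ^ 2 = (d ^ 2 - d ^ 2 * (y * d)) / M ^ 3 := by
    field_simp
    linear_combination (M ^ 2 - d * M + d ^ 2) * hyd
  rw [e, abs_div, abs_of_pos (by positivity : 0 < M ^ 3)]
  gcongr
  have hd4 : |d| ^ 4 = d ^ 4 := by rw [← abs_pow]; exact abs_of_nonneg (by positivity)
  have h1 : |d ^ 2 - d ^ 2 * (y * d)| ≤ |d| ^ 2 + |d| ^ 3 := by
    refine (abs_sub _ _).trans ?_
    rw [abs_mul, abs_mul, abs_pow, abs_of_pos hy]
    have : |d| ^ 2 * (y * |d|) ≤ |d| ^ 2 * (1 * |d|) := by gcongr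
    linarith
  refine h1.trans ?_
  rw [← hd4]
  generalize |d| = t
  nlinarith [sq_nonneg (t ^ 2 - t), sq_nonneg (t - 1), sq_nonneg (t ^ 2 - 1), sq_nonneg t]

lemma sq_sub_inv_le {y M : ℝ} (hy : 0 < y) (hy1 : y ≤ 1) (hM : 1 ≤ M) :
    (y - 1 / M) ^ 2 ≤ 4 * (1 + (y⁻¹ - M) ^ 4) / M ^ 4 := by
  have hM0 : 0 < M := by linarith
  obtain ⟨d, hd⟩ : ∃ d, d = y⁻¹ - M := ⟨_, rfl⟩
  rw [← hd]
  have hyd : y * d = 1 - M * y := by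
    rw [hd, mul_sub, mul_inv_cancel₀ hy.ne']
    ring
  have e : y - 1 / M = -(d - d * (y * d)) / M ^ 2 := by
    field_simp
    linear_combination (M - d) * hyd
  rw [e, div_pow, ← pow_mul, neg_sq]
  norm_num only
  gcongr
  have h0 : (d * (y * d)) ^ 2 ≤ d ^ 4 := by
    have : y ^ 2 ≤ 1 := pow_le_one₀ hy.le hy1
    nlinarith [mul_le_mul_of_nonneg_right this (by positivity : 0 ≤ d ^ 4)]
  nlinarith [sq_nonneg (d + d * (y * d)), sq_nonneg (d ^ 2 - 1)]

end Approximation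

/-- The conditional mean of the `m`-th summand of `piHat` given the sieve below `m`. -/
noncomputable def condMean (A : Set ℕ) (m : ℕ) : ℝ :=
  if 2 ≤ m then (1 - 1 / (m : ℝ)) * hawkinsY A m else 0

/-- The reciprocal of the weight of `m` in `piHat`. -/
noncomputable def pairWeight (A : Set ℕ) (m : ℕ) : ℝ :=
  hawkinsY A m - (1 / ((m : ℝ) + 1)) * (1 - 1 / (m : ℝ)) * (hawkinsY A m) ^ 2

/-- The `m`-th summand of `piHat`. -/
noncomputable def pairTerm (A : Set ℕ) (m : ℕ) : ℝ :=
  if m ∈ A ∧ m + 2 ∈ A then (pairWeight A m)⁻¹ else 0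

lemma piHat_eq_sum_pairTerm (A : Set ℕ) (n : ℕ) :
    piHat A n = ∑ m ∈ Finset.range (n + 1), pairTerm A m := rfl

lemma dependsBelow_condMean (m : ℕ) : DependsBelow m fun A => condMean A m :=
  (dependsBelow_hawkinsY m).comp fun y => if 2 ≤ m then (1 - 1 / (m : ℝ)) * y else 0

lemma dependsBelow_pairWeight (m : ℕ) : DependsBelow m fun A => pairWeight A m :=
  (dependsBelow_hawkinsY m).comp fun y =>
    y - (1 / ((m : ℝ) + 1)) * (1 - 1 / (m : ℝ)) * y ^ 2

lemma dependsBelow_pairTerm (m : ℕ) : DependsBelow (m + 3) fun A => pairTerm A m := by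
  intro A B hAB
  have h := (dependsBelow_pairWeight m).mono (by lia : m ≤ m + 3) A B hAB
  simp only at h
  simp only [pairTerm, h, hAB m (by lia), hAB (m + 2) (by lia)]

lemma dependsBelow_piHat (n : ℕ) : DependsBelow (n + 3) fun A => piHat A n := by
  simp_rw [piHat_eq_sum_pairTerm]
  refine DependsBelow.sum _ fun m hm => (dependsBelow_pairTerm m).mono ?_
  have := Finset.mem_range.1 hm
  lia

lemma condMean_nonneg {A : Set ℕ} (hA : ∀ n ∈ A, 2 ≤ n) (m : ℕ) : 0 ≤ condMean A m := by
  unfold condMean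
  split_ifs with hm
  · have hm' : (2 : ℝ) ≤ m := by exact_mod_cast hm
    have : 1 / (m : ℝ) ≤ 1 := by rw [div_le_one (by linarith)]; linarith
    exact mul_nonneg (by linarith) (hawkinsY_pos hA m).le
  · exact le_rfl

lemma condMean_le {A : Set ℕ} (hA : ∀ n ∈ A, 2 ≤ n) (m : ℕ) :
    condMean A m ≤ hawkinsY A m := by
  have h0 := hawkinsY_pos hA m
  unfold condMean
  split_ifs with hm
  · have : 0 ≤ 1 / (m : ℝ) := by positivity
    nlinarith
  · exact h0.le

lemma half_hawkinsY_le_pairWeight {A : Set ℕ} (hA : ∀ n ∈ A, 2 ≤ n) {m : ℕ} (hm : 2 ≤ m) :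
    hawkinsY A m / 2 ≤ pairWeight A m := by
  have h0 := hawkinsY_pos hA m
  have h1 := hawkinsY_le_one hA m
  have hm' : (2 : ℝ) ≤ m := by exact_mod_cast hm
  have h2 : 1 / ((m : ℝ) + 1) ≤ 1 / 2 := one_div_le_one_div_of_le (by norm_num) (by linarith)
  have h3 : 0 ≤ 1 / (m : ℝ) := by positivity
  have h4 : 1 / (m : ℝ) ≤ 1 := by rw [div_le_one (by linarith)]; linarith
  have h5 : 1 / ((m : ℝ) + 1) * (1 - 1 / m) * hawkinsY A m ^ 2
      ≤ 1 / 2 * 1 * (hawkinsY A m * 1) := by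
    rw [sq]
    have : 0 ≤ 1 - 1 / (m : ℝ) := by linarith
    gcongr
    linarith
  unfold pairWeight
  linarith

section MomentBounds

variable {Ω : Type*} [MeasurableSpace Ω] {μ : Measure Ω} {α : Ω → Set ℕ}

lemma IsHawkinsSieve.exists_integral_invDev_pow_four_le (h : IsHawkinsSieve μ α) :
    ∃ C, ∀ m, 2 ≤ m → ∫ ω, invDev (α ω) m ^ 4 ∂μ ≤ C := by
  set g : ℕ → ℝ := fun m => 20 * (Mharm m / ((m : ℝ) - 1) ^ 2) with hg
  have hgs : Summable g := summable_Mharm_div_sq.mul_left 20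
  have hg0 : ∀ m, 0 ≤ g m := fun m => by
    have := one_le_Mharm m
    positivity
  have key : ∀ m, 2 ≤ m → 1 + ∫ ω, invDev (α ω) m ^ 4 ∂μ
      ≤ Real.exp (∑ i ∈ Finset.range m, g i) := by
    intro m hm
    induction m, hm using Nat.le_induction with
    | base =>
      have : ∫ ω, invDev (α ω) 2 ^ 4 ∂μ = 0 := by
        simp [invDev, hawkinsY_two (h.mem_ge_two _), Mharm]
      rw [this, add_zero]
      exact Real.one_le_exp (Finset.sum_nonneg fun i _ => hg0 i)
    | succ m hm ih =>
      rw [Finset.sum_range_succ, Real.exp_add, mul_comm]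
      refine (h.integral_invDev_pow_four_succ_le hm).trans ?_
      have h1 : 0 ≤ ∫ ω, invDev (α ω) m ^ 4 ∂μ := integral_nonneg fun ω => by positivity
      have h2 := Real.add_one_le_exp (g m)
      gcongr
      linarith
  refine ⟨Real.exp (∑' i, g i), fun m hm => ?_⟩
  have h1 := Real.exp_le_exp.2 (hgs.sum_le_tsum (Finset.range m) fun i _ => hg0 i)
  linarith [key m hm]

lemma IsHawkinsSieve.isBigO_integral_condMean_sub (h : IsHawkinsSieve μ α) :
    (fun m => ∫ ω, (condMean (α ω) m - 1 / Mharm m) ∂μ) =O[atTop] fun m => 1 / Mharm m ^ 3 := by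
  have := h.isProb
  obtain ⟨C, hC⟩ := h.exists_integral_invDev_pow_four_le
  have h1 : (fun m => ∫ ω, (hawkinsY (α ω) m - 1 / Mharm m) ∂μ)
      =O[atTop] fun m => 1 / Mharm m ^ 3 := by
    refine IsBigO.of_bound (2 * (1 + C)) ?_
    filter_upwards [eventually_ge_atTop 2] with m hm
    have hM := one_le_Mharm m
    have hi : Integrable (fun ω => hawkinsY (α ω) m - 1 / Mharm m) μ :=
      h.integrable ((dependsBelow_hawkinsY m).comp (· - 1 / Mharm m))
    have hd := h.integrable (dependsBelow_invDev m)
    have hd4 : Integrable (fun ω => invDev (α ω) m ^ 4) μ :=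
      h.integrable ((dependsBelow_invDev m).comp (· ^ 4))
    have e : ∫ ω, (hawkinsY (α ω) m - 1 / Mharm m) ∂μ
        = ∫ ω, (hawkinsY (α ω) m - 1 / Mharm m + invDev (α ω) m / Mharm m ^ 2) ∂μ := by
      rw [integral_add hi (hd.div_const _), integral_div, h.integral_invDev hm]
      simp
    rw [e]
    refine (norm_integral_le_integral_norm _).trans ?_
    have hle : ∫ ω, ‖hawkinsY (α ω) m - 1 / Mharm m + invDev (α ω) m / Mharm m ^ 2‖ ∂μ
        ≤ ∫ ω, (2 + 2 * invDev (α ω) m ^ 4) / Mharm m ^ 3 ∂μ := by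
      refine integral_mono (hi.add (hd.div_const _)).norm
        (((integrable_const _).add (hd4.const_mul 2)).div_const _) fun ω => ?_
      refine (abs_sub_inv_add_le (hawkinsY_pos (h.mem_ge_two ω) m)
        (hawkinsY_le_one (h.mem_ge_two ω) m) hM).trans_eq ?_
      simp only [invDev]
      ring
    refine hle.trans ?_
    rw [integral_div, integral_add (integrable_const _) (hd4.const_mul 2), integral_const_mul,
      Real.norm_of_nonneg (by positivity), mul_one_div]
    simp only [integral_const, probReal_univ, smul_eq_mul, one_mul]
    gcongr
    linarith [hC m hm]
  have h2 : (fun m : ℕ => ∫ ω, hawkinsY (α ω) m / m ∂μ) =O[atTop] fun m => 1 / Mharm m ^ 3 := by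
    refine IsBigO.trans (IsBigO.of_bound 1 (Eventually.of_forall fun m => ?_))
      (isBigO_inv_nat_Mharm 3)
    have hy := h.integrable (dependsBelow_hawkinsY m)
    have h0 : 0 ≤ ∫ ω, hawkinsY (α ω) m ∂μ :=
      integral_nonneg fun ω => (hawkinsY_pos (h.mem_ge_two ω) m).le
    have h1 : ∫ ω, hawkinsY (α ω) m ∂μ ≤ 1 := by
      have := integral_mono hy (integrable_const 1) fun ω => hawkinsY_le_one (h.mem_ge_two ω) m
      simpa using this
    rw [integral_div, Real.norm_of_nonneg (by positivity), Real.norm_of_nonneg (by positivity),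
      one_mul]
    gcongr
  refine (h1.sub h2).congr' ?_ EventuallyEq.rfl
  filter_upwards [eventually_ge_atTop 2] with m hm
  have hy := dependsBelow_hawkinsY m
  rw [← integral_sub (h.integrable (hy.comp (· - 1 / Mharm m)))
    (h.integrable (hy.comp (· / (m : ℝ))))]
  refine integral_congr_ae (Eventually.of_forall fun ω => ?_)
  simp only [condMean, if_pos hm]
  ring

lemma IsHawkinsSieve.isBigO_integral_condMean_sub_sq (h : IsHawkinsSieve μ α) :
    (fun m => ∫ ω, (condMean (α ω) m - 1 / Mharm m) ^ 2 ∂μ)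
      =O[atTop] fun m => 1 / Mharm m ^ 4 := by
  have := h.isProb
  obtain ⟨C, hC⟩ := h.exists_integral_invDev_pow_four_le
  have h1 : (fun m : ℕ => 8 * (1 + C) * (1 / Mharm m ^ 4) + 2 * (1 / (m : ℝ)))
      =O[atTop] fun m => 1 / Mharm m ^ 4 :=
    ((isBigO_refl _ _).const_mul_left _).add ((isBigO_inv_nat_Mharm 4).const_mul_left 2)
  refine IsBigO.trans (IsBigO.of_bound 1 ?_) h1
  filter_upwards [eventually_ge_atTop 2] with m hm
  have hM := one_le_Mharm m
  have hm' : (2 : ℝ) ≤ m := by exact_mod_cast hm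
  have hd4 : Integrable (fun ω => invDev (α ω) m ^ 4) μ :=
    h.integrable ((dependsBelow_invDev m).comp (· ^ 4))
  have hi : Integrable (fun ω => 8 + 8 * invDev (α ω) m ^ 4) μ :=
    (integrable_const _).add (hd4.const_mul 8)
  have hle : ∫ ω, (condMean (α ω) m - 1 / Mharm m) ^ 2 ∂μ
      ≤ ∫ ω, ((8 + 8 * invDev (α ω) m ^ 4) / Mharm m ^ 4 + 2 * (1 / (m : ℝ))) ∂μ := by
    refine integral_mono (h.integrable ((dependsBelow_condMean m).comp
      fun c => (c - 1 / Mharm m) ^ 2)) ((hi.div_const _).add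
      (integrable_const _)) fun ω => ?_
    have hy := hawkinsY_pos (h.mem_ge_two ω) m
    have hy1 := hawkinsY_le_one (h.mem_ge_two ω) m
    have h2 := sq_sub_inv_le hy hy1 hM
    have h3 : (hawkinsY (α ω) m / m) ^ 2 ≤ 1 / (m : ℝ) := by
      rw [div_pow, div_le_div_iff₀ (by positivity) (by positivity)]
      have : hawkinsY (α ω) m ^ 2 ≤ 1 := pow_le_one₀ hy.le hy1
      nlinarith
    have e : condMean (α ω) m - 1 / Mharm m
        = (hawkinsY (α ω) m - 1 / Mharm m) - hawkinsY (α ω) m / m := by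
      simp only [condMean, if_pos hm]
      ring
    have e2 : (8 + 8 * invDev (α ω) m ^ 4) / Mharm m ^ 4
        = 2 * (4 * (1 + ((hawkinsY (α ω) m)⁻¹ - Mharm m) ^ 4) / Mharm m ^ 4) := by
      simp only [invDev]
      ring
    simp only [e, e2]
    nlinarith [sq_nonneg ((hawkinsY (α ω) m - 1 / Mharm m) + hawkinsY (α ω) m / m)]
  have h0 : 0 ≤ ∫ ω, (condMean (α ω) m - 1 / Mharm m) ^ 2 ∂μ :=
    integral_nonneg fun ω => sq_nonneg _
  rw [Real.norm_of_nonneg h0, one_mul]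
  refine hle.trans (le_trans ?_ (le_abs_self _))
  rw [integral_add (hi.div_const _) (integrable_const _), integral_div, integral_add (integrable_const _) (hd4.const_mul 8),
    integral_const_mul]
  simp only [integral_const, probReal_univ, smul_eq_mul, one_mul]
  rw [mul_one_div (8 * (1 + C))]
  gcongr
  linarith [hC m hm]

lemma IsHawkinsSieve.integral_mul_pairTerm (h : IsHawkinsSieve μ α) {m : ℕ}
    {f : Set ℕ → ℝ} (hf : DependsBelow m f) :
    ∫ ω, f (α ω) * pairTerm (α ω) m ∂μ = ∫ ω, f (α ω) * condMean (α ω) m ∂μ := by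
  by_cases hm : 2 ≤ m
  swap
  · have h1 : ∀ ω, pairTerm (α ω) m = 0 := fun ω =>
      if_neg fun hω => hm (h.mem_ge_two ω m hω.1)
    simp [h1, condMean, hm]
  have hm' : (2 : ℝ) ≤ m := by exact_mod_cast hm
  have hy := dependsBelow_hawkinsY m
  have hq := dependsBelow_pairWeight m
  have hfq : DependsBelow m fun A => f A * (pairWeight A m)⁻¹ := hf.comp₂ hq fun a b => a * b⁻¹
  set R : Set ℕ → ℝ := fun A => f A * (pairWeight A m)⁻¹ * if m ∈ A then 1 else 0 with hR
  have hRd : DependsBelow (m + 1) R :=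
    (hfq.mono m.le_succ).comp₂ (dependsBelow_indicator m.lt_succ_self) (· * ·)
  have hy1 := dependsBelow_hawkinsY (m + 1)
  have hRy : DependsBelow (m + 1) fun A => R A * hawkinsY A (m + 1) := hRd.comp₂ hy1 (· * ·)
  have hRyc : DependsBelow (m + 1) fun A =>
      R A * hawkinsY A (m + 1) * (1 - 1 / ((m : ℝ) + 1)) :=
    hRy.comp (· * (1 - 1 / ((m : ℝ) + 1)))
  calc ∫ ω, f (α ω) * pairTerm (α ω) m ∂μ
      = ∫ ω, R (α ω) * (if m + 2 ∈ α ω then 1 else 0) ∂μ := by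
        congr 1 with ω
        by_cases h1 : m ∈ α ω <;> by_cases h2 : m + 2 ∈ α ω <;> simp [hR, pairTerm, h1, h2]
    _ = ∫ ω, R (α ω) * hawkinsY (α ω) (m + 2) ∂μ :=
        h.integral_mul_indicator (by lia) (hRd.mono (by lia))
    _ = ∫ ω, (if m + 1 ∈ α ω then R (α ω) * hawkinsY (α ω) (m + 1) * (1 - 1 / ((m : ℝ) + 1))
          else R (α ω) * hawkinsY (α ω) (m + 1)) ∂μ := by
        congr 1 with ω
        rw [hawkinsY_succ (α ω) (m + 1)]
        push_cast
        split_ifs <;> ring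
    _ = ∫ ω, (hawkinsY (α ω) (m + 1) * (R (α ω) * hawkinsY (α ω) (m + 1)
          * (1 - 1 / ((m : ℝ) + 1))) + (1 - hawkinsY (α ω) (m + 1))
          * (R (α ω) * hawkinsY (α ω) (m + 1))) ∂μ :=
        h.integral_ite (by lia) hRyc hRy
    _ = ∫ ω, (f (α ω) * (1 - 1 / (m : ℝ))) * (if m ∈ α ω then 1 else 0) ∂μ := by
        congr 1 with ω
        have hq0 : pairWeight (α ω) m ≠ 0 := by
          have h1 := hawkinsY_pos (h.mem_ge_two ω) m
          have h2 := half_hawkinsY_le_pairWeight (h.mem_ge_two ω) hm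
          exact (by linarith : 0 < pairWeight (α ω) m).ne'
        by_cases h1 : m ∈ α ω
        · have h3 : ∀ c, f (α ω) * (pairWeight (α ω) m)⁻¹ * c * pairWeight (α ω) m
              = f (α ω) * c := fun c => by field_simp
          rw [hawkinsY_succ, if_pos h1]
          simp only [hR, if_pos h1, mul_one]
          rw [← h3 (1 - 1 / (m : ℝ))]
          have hqe : pairWeight (α ω) m = hawkinsY (α ω) m
            - (1 / ((m : ℝ) + 1)) * (1 - 1 / (m : ℝ)) * (hawkinsY (α ω) m) ^ 2 := rfl
          linear_combination
            -(f (α ω) * (pairWeight (α ω) m)⁻¹ * (1 - 1 / (m : ℝ))) * hqe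
        · simp [hR, h1]
    _ = ∫ ω, (f (α ω) * (1 - 1 / (m : ℝ))) * hawkinsY (α ω) m ∂μ :=
        h.integral_mul_indicator hm (hf.comp (· * (1 - 1 / (m : ℝ))))
    _ = _ := by
        congr 1 with ω
        simp only [condMean, if_pos hm]
        ring

end MomentBounds

section Assembly

variable {Ω : Type*} [MeasurableSpace Ω] {μ : Measure Ω} {α : Ω → Set ℕ}

/-- The `m`-th summand of `piHat`, centred by its conditional mean. -/
noncomputable def centredTerm (A : Set ℕ) (m : ℕ) : ℝ := pairTerm A m - condMean A m

lemma dependsBelow_centredTerm (m : ℕ) : DependsBelow (m + 3) fun A => centredTerm A m :=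
  (dependsBelow_pairTerm m).comp₂ ((dependsBelow_condMean m).mono (by lia)) (· - ·)

lemma dependsBelow_sum_centredTerm (n : ℕ) :
    DependsBelow (n + 2) fun A => ∑ m ∈ Finset.range n, centredTerm A m := by
  refine DependsBelow.sum _ fun m hm => (dependsBelow_centredTerm m).mono ?_
  have := Finset.mem_range.1 hm
  lia

lemma IsHawkinsSieve.integral_mul_centredTerm (h : IsHawkinsSieve μ α) {m : ℕ}
    {f : Set ℕ → ℝ} (hf : DependsBelow m f) :
    ∫ ω, f (α ω) * centredTerm (α ω) m ∂μ = 0 := by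
  simp only [centredTerm, mul_sub]
  rw [integral_sub, h.integral_mul_pairTerm hf, sub_self]
  · exact h.integrable ((hf.mono (by lia)).comp₂ (dependsBelow_pairTerm m) (· * ·))
  · exact h.integrable (hf.comp₂ (dependsBelow_condMean m) (· * ·))

lemma IsHawkinsSieve.integral_centredTerm_sq_le (h : IsHawkinsSieve μ α) (m : ℕ) :
    ∫ ω, centredTerm (α ω) m ^ 2 ∂μ ≤ 6 := by
  have := h.isProb
  by_cases hm : 2 ≤ m
  swap
  · have h1 : ∀ ω, pairTerm (α ω) m = 0 := fun ω =>
      if_neg fun hω => hm (h.mem_ge_two ω m hω.1)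
    simp [centredTerm, h1, condMean, hm]
  have hX := dependsBelow_pairTerm m
  have hP := dependsBelow_condMean m
  have hq := dependsBelow_pairWeight m
  have hXi : Integrable (fun ω => pairTerm (α ω) m ^ 2) μ := h.integrable (hX.comp (· ^ 2))
  have hXle : ∫ ω, pairTerm (α ω) m ^ 2 ∂μ ≤ 2 := by
    have e : ∀ ω, pairTerm (α ω) m ^ 2 = (pairWeight (α ω) m)⁻¹ * pairTerm (α ω) m := by
      intro ω
      unfold pairTerm
      split_ifs <;> ring
    simp_rw [e]
    rw [h.integral_mul_pairTerm (hq.comp fun q => q⁻¹)]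
    have hle : ∫ ω, (pairWeight (α ω) m)⁻¹ * condMean (α ω) m ∂μ ≤ ∫ _, (2 : ℝ) ∂μ := by
      refine integral_mono (h.integrable (hq.comp₂ hP fun q p => q⁻¹ * p))
        (integrable_const _) fun ω => ?_
      have h1 := hawkinsY_pos (h.mem_ge_two ω) m
      have h2 := half_hawkinsY_le_pairWeight (h.mem_ge_two ω) hm
      have h3 := condMean_le (h.mem_ge_two ω) m
      have h4 : 0 < pairWeight (α ω) m := by linarith
      change (pairWeight (α ω) m)⁻¹ * condMean (α ω) m ≤ 2
      rw [inv_mul_le_iff₀ h4]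
      linarith
    simpa using hle
  have hle : ∫ ω, centredTerm (α ω) m ^ 2 ∂μ ≤ ∫ ω, (2 * pairTerm (α ω) m ^ 2 + 2) ∂μ := by
    refine integral_mono (h.integrable ((dependsBelow_centredTerm m).comp (· ^ 2)))
      ((hXi.const_mul 2).add (integrable_const _)) fun ω => ?_
    have h1 := condMean_nonneg (h.mem_ge_two ω) m
    have h2 := (condMean_le (h.mem_ge_two ω) m).trans (hawkinsY_le_one (h.mem_ge_two ω) m)
    simp only [centredTerm]
    nlinarith [sq_nonneg (pairTerm (α ω) m + condMean (α ω) m)]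
  rw [integral_add (hXi.const_mul 2) (integrable_const _), integral_const_mul] at hle
  simp only [integral_const, probReal_univ, smul_eq_mul, one_mul] at hle
  linarith

lemma IsHawkinsSieve.integral_sum_centredTerm_sq_le (h : IsHawkinsSieve μ α) (n : ℕ) :
    ∫ ω, (∑ m ∈ Finset.range n, centredTerm (α ω) m) ^ 2 ∂μ ≤ 30 * n := by
  have hDi : ∀ m, Integrable (fun ω => centredTerm (α ω) m ^ 2) μ := fun m =>
    h.integrable ((dependsBelow_centredTerm m).comp (· ^ 2))
  have hD := h.integral_centredTerm_sq_le
  have hSi : ∀ n, Integrable (fun ω => (∑ m ∈ Finset.range n, centredTerm (α ω) m) ^ 2) μ :=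
    fun n => h.integrable ((dependsBelow_sum_centredTerm n).comp (· ^ 2))
  match n with
  | 0 => simp
  | 1 => simpa using (hD 0).trans (by norm_num)
  | n + 2 =>
    induction n with
    | zero =>
      have hle : ∫ ω, (∑ m ∈ Finset.range (0 + 2), centredTerm (α ω) m) ^ 2 ∂μ
          ≤ ∫ ω, (2 * centredTerm (α ω) 0 ^ 2 + 2 * centredTerm (α ω) 1 ^ 2) ∂μ := by
        refine integral_mono (hSi _) (((hDi 0).const_mul 2).add ((hDi 1).const_mul 2)) fun ω => ?_
        simp only [zero_add, Finset.sum_range_succ, Finset.sum_range_zero]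
        nlinarith [sq_nonneg (centredTerm (α ω) 0 - centredTerm (α ω) 1)]
      rw [integral_add ((hDi 0).const_mul 2) ((hDi 1).const_mul 2), integral_const_mul,
        integral_const_mul] at hle
      push_cast
      linarith [hD 0, hD 1]
    | succ n ih =>
      have hS := dependsBelow_sum_centredTerm n
      have hcross := h.integral_mul_centredTerm hS
      have hci : Integrable (fun ω =>
          (∑ m ∈ Finset.range n, centredTerm (α ω) m) * centredTerm (α ω) (n + 2)) μ :=
        h.integrable ((hS.mono (by lia)).comp₂ (dependsBelow_centredTerm (n + 2)) (· * ·))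
      have i0 := hSi (n + 2)
      have i1 := hci.const_mul 2
      have i2 := hDi n
      have i3 := hDi (n + 1)
      have i4 := (hDi (n + 2)).const_mul 3
      have i01 := i0.fun_add i1
      have i012 := i01.fun_add i2
      have i0123 := i012.fun_add i3
      have hle : ∫ ω, (∑ m ∈ Finset.range (n + 1 + 2), centredTerm (α ω) m) ^ 2 ∂μ
          ≤ ∫ ω, ((∑ m ∈ Finset.range (n + 2), centredTerm (α ω) m) ^ 2
            + 2 * ((∑ m ∈ Finset.range n, centredTerm (α ω) m) * centredTerm (α ω) (n + 2))
            + centredTerm (α ω) n ^ 2 + centredTerm (α ω) (n + 1) ^ 2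
            + 3 * centredTerm (α ω) (n + 2) ^ 2) ∂μ := by
        refine integral_mono (hSi _) (i0123.fun_add i4) fun ω => ?_
        simp only [Finset.sum_range_succ]
        nlinarith [sq_nonneg (centredTerm (α ω) n - centredTerm (α ω) (n + 2)),
          sq_nonneg (centredTerm (α ω) (n + 1) - centredTerm (α ω) (n + 2))]
      rw [integral_add i0123 i4, integral_add i012 i3, integral_add i01 i2, integral_add i0 i1,
        integral_const_mul, integral_const_mul, hcross] at hle
      push_cast at ih ⊢
      linarith [hD n, hD (n + 1), hD (n + 2)]

lemma piHat_sub_mainTerm (A : Set ℕ) (n : ℕ) :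
    piHat A n - mainTerm n = ∑ m ∈ Finset.range (n + 1), centredTerm A m
      + ∑ m ∈ Finset.range (n + 1), (condMean A m - 1 / Mharm m)
      + (∑ m ∈ Finset.range (n + 1), 1 / Mharm m - mainTerm n) := by
  simp only [piHat_eq_sum_pairTerm, centredTerm, Finset.sum_sub_distrib]
  ring

lemma IsHawkinsSieve.isBigO_integral_piHat_sub (h : IsHawkinsSieve μ α) :
    (fun n => ∫ ω, (piHat (α ω) n - mainTerm n) ∂μ)
      =O[atTop] fun n => (n : ℝ) / Mharm n ^ 3 := by
  have := h.isProb
  refine ((isBigO_sum_range_Mharm 3 h.isBigO_integral_condMean_sub).add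
    isBigO_sum_inv_Mharm_sub_mainTerm).congr_left fun n => ?_
  have hE : ∀ m, Integrable (fun ω => condMean (α ω) m - 1 / Mharm m) μ := fun m =>
    h.integrable ((dependsBelow_condMean m).comp (· - 1 / Mharm m))
  have hD : ∀ m, Integrable (fun ω => centredTerm (α ω) m) μ := fun m =>
    h.integrable (dependsBelow_centredTerm m)
  have hD0 : ∀ m, ∫ ω, centredTerm (α ω) m ∂μ = 0 := fun m => by
    simpa using h.integral_mul_centredTerm (m := m) (f := fun _ => 1) fun _ _ _ => rfl
  have i1 := integrable_finsetSum (Finset.range (n + 1)) fun m _ => hD m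
  have i2 := integrable_finsetSum (Finset.range (n + 1)) fun m _ => hE m
  simp_rw [piHat_sub_mainTerm]
  rw [integral_add (i1.fun_add i2) (integrable_const _), integral_add i1 i2,
    integral_finsetSum _ fun m _ => hD m, integral_finsetSum _ fun m _ => hE m]
  simp [hD0]

lemma IsHawkinsSieve.isBigO_integral_sum_condMean_sq (h : IsHawkinsSieve μ α) :
    (fun n => ∫ ω, (∑ m ∈ Finset.range (n + 1), (condMean (α ω) m - 1 / Mharm m)) ^ 2 ∂μ)
      =O[atTop] fun n => (n : ℝ) ^ 2 / Mharm n ^ 4 := by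
  have hE2 : ∀ m, Integrable (fun ω => (condMean (α ω) m - 1 / Mharm m) ^ 2) μ := fun m =>
    h.integrable ((dependsBelow_condMean m).comp fun c => (c - 1 / Mharm m) ^ 2)
  have h1 : (fun m => Mharm m ^ 2 * ∫ ω, (condMean (α ω) m - 1 / Mharm m) ^ 2 ∂μ)
      =O[atTop] fun m => 1 / Mharm m ^ 2 := by
    refine ((isBigO_refl (fun m => Mharm m ^ 2) atTop).mul
      h.isBigO_integral_condMean_sub_sq).congr_right fun m => ?_
    have := one_le_Mharm m
    field_simp
  have h2 := (isBigO_sum_range_Mharm 2 (isBigO_refl _ _)).mul (isBigO_sum_range_Mharm 2 h1)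
  refine IsBigO.trans (IsBigO.of_bound 1 (Eventually.of_forall fun n => ?_))
    (h2.congr_right fun n => by ring)
  rw [Real.norm_of_nonneg (integral_nonneg fun ω => sq_nonneg _), one_mul]
  refine le_trans ?_ (le_abs_self _)
  have hi : Integrable (fun ω => ∑ m ∈ Finset.range (n + 1),
      Mharm m ^ 2 * (condMean (α ω) m - 1 / Mharm m) ^ 2) μ :=
    integrable_finsetSum _ fun m _ => (hE2 m).const_mul _
  have hle : ∫ ω, (∑ m ∈ Finset.range (n + 1), (condMean (α ω) m - 1 / Mharm m)) ^ 2 ∂μ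
      ≤ ∫ ω, (∑ m ∈ Finset.range (n + 1), 1 / Mharm m ^ 2) * ∑ m ∈ Finset.range (n + 1),
        Mharm m ^ 2 * (condMean (α ω) m - 1 / Mharm m) ^ 2 ∂μ := by
    refine integral_mono (h.integrable (m := n + 1) (f := fun A =>
      (∑ m ∈ Finset.range (n + 1), (condMean A m - 1 / Mharm m)) ^ 2) ?_)
      (hi.const_mul _) fun ω => ?_
    · refine DependsBelow.comp (DependsBelow.sum _ fun m hm => ?_) (· ^ 2)
      exact ((dependsBelow_condMean m).comp (· - 1 / Mharm m)).mono (Finset.mem_range.1 hm).le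
    · refine Finset.sum_sq_le_sum_mul_sum_of_sq_le_mul _ (fun m _ => by positivity)
        (fun m _ => by positivity) fun m _ => le_of_eq ?_
      have := one_le_Mharm m
      field_simp
  refine hle.trans_eq ?_
  rw [integral_const_mul, integral_finsetSum _ fun m _ => (hE2 m).const_mul _]
  simp_rw [integral_const_mul]

lemma isBigO_nat_sq_div_Mharm :
    (fun n : ℕ => (n : ℝ)) =O[atTop] fun n => (n : ℝ) ^ 2 / Mharm n ^ 4 := by
  refine ((isBigO_refl (fun n : ℕ => (n : ℝ) ^ 2) atTop).mul (isBigO_inv_nat_Mharm 4)).congr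
    (fun n => ?_) fun n => mul_one_div _ _
  rcases eq_or_ne (n : ℝ) 0 with h | h
  · simp [h]
  · field_simp

lemma IsHawkinsSieve.isBigO_integral_piHat_sub_sq (h : IsHawkinsSieve μ α) :
    (fun n => ∫ ω, (piHat (α ω) n - mainTerm n) ^ 2 ∂μ)
      =O[atTop] fun n => (n : ℝ) ^ 2 / Mharm n ^ 4 := by
  have := h.isProb
  have hr : (fun n => (∑ m ∈ Finset.range (n + 1), 1 / Mharm m - mainTerm n) ^ 2)
      =O[atTop] fun n => (n : ℝ) ^ 2 / Mharm n ^ 4 := by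
    refine (isBigO_sum_inv_Mharm_sub_mainTerm.pow 2).trans
      (IsBigO.of_bound 1 (Eventually.of_forall fun n => ?_))
    have hM := one_le_Mharm n
    rw [Real.norm_of_nonneg (by positivity), Real.norm_of_nonneg (by positivity), one_mul,
      div_pow, ← pow_mul]
    gcongr
    norm_num
  have hS : (fun n => ∫ ω, (∑ m ∈ Finset.range (n + 1), centredTerm (α ω) m) ^ 2 ∂μ)
      =O[atTop] fun n => (n : ℝ) ^ 2 / Mharm n ^ 4 := by
    refine IsBigO.trans (IsBigO.of_bound 60 ?_) isBigO_nat_sq_div_Mharm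
    filter_upwards [eventually_ge_atTop 1] with n hn
    have hn' : (1 : ℝ) ≤ n := by exact_mod_cast hn
    rw [Real.norm_of_nonneg (integral_nonneg fun ω => sq_nonneg _),
      Real.norm_of_nonneg (by positivity)]
    have := h.integral_sum_centredTerm_sq_le (n + 1)
    push_cast at this
    linarith
  refine IsBigO.trans (IsBigO.of_bound 1 (Eventually.of_forall fun n => ?_))
    (((hS.const_mul_left 3).add (h.isBigO_integral_sum_condMean_sq.const_mul_left 3)).add
      (hr.const_mul_left 3))
  rw [Real.norm_of_nonneg (integral_nonneg fun ω => sq_nonneg _), one_mul]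
  refine le_trans ?_ (le_abs_self _)
  have i1 : Integrable (fun ω => (∑ m ∈ Finset.range (n + 1), centredTerm (α ω) m) ^ 2) μ :=
    h.integrable ((dependsBelow_sum_centredTerm (n + 1)).comp (· ^ 2))
  have i2 : Integrable (fun ω =>
      (∑ m ∈ Finset.range (n + 1), (condMean (α ω) m - 1 / Mharm m)) ^ 2) μ := by
    refine h.integrable (m := n + 1) (f := fun A =>
      (∑ m ∈ Finset.range (n + 1), (condMean A m - 1 / Mharm m)) ^ 2) ?_
    refine DependsBelow.comp (DependsBelow.sum _ fun m hm => ?_) (· ^ 2)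
    exact ((dependsBelow_condMean m).comp (· - 1 / Mharm m)).mono (Finset.mem_range.1 hm).le
  have i12 := (i1.const_mul 3).add (i2.const_mul 3)
  have i3 : Integrable (fun _ : Ω =>
      3 * (∑ m ∈ Finset.range (n + 1), 1 / Mharm m - mainTerm n) ^ 2) μ := integrable_const _
  have hle := integral_mono (μ := μ)
    (h.integrable ((dependsBelow_piHat n).comp fun x => (x - mainTerm n) ^ 2))
    (i12.add i3) fun ω => by
      simp only [piHat_sub_mainTerm, Pi.add_apply]
      generalize ∑ m ∈ Finset.range (n + 1), centredTerm (α ω) m = a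
      generalize ∑ m ∈ Finset.range (n + 1), (condMean (α ω) m - 1 / Mharm m) = b
      generalize ∑ m ∈ Finset.range (n + 1), 1 / Mharm m - mainTerm n = c
      nlinarith [sq_nonneg (a - b), sq_nonneg (b - c), sq_nonneg (a - c)]
  refine hle.trans_eq ?_
  rw [integral_add' i12 i3, integral_add' (i1.const_mul 3) (i2.const_mul 3), integral_const_mul,
    integral_const_mul]
  simp

end Assembly

theorem piHat_second_moment_and_variance {Ω : Type*} [MeasurableSpace Ω] (μ : Measure Ω)
    (α : Ω → Set ℕ) (h : IsHawkinsSieve μ α) :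
    ((fun n : ℕ =>
        (∫ ω, (piHat (α ω) n) ^ 2 ∂μ) -
          ((n : ℝ) ^ 2 / (Mharm n) ^ 2 + 2 * (n : ℝ) ^ 2 / (Mharm n) ^ 3))
      =O[atTop] fun n : ℕ => (n : ℝ) ^ 2 / (Mharm n) ^ 4) ∧
    ((fun n : ℕ => (∫ ω, (piHat (α ω) n) ^ 2 ∂μ) - (∫ ω, piHat (α ω) n ∂μ) ^ 2)
      =O[atTop] fun n : ℕ => (n : ℝ) ^ 2 / (Mharm n) ^ 4) := by
  have := h.isProb
  have hI : ∀ n, Integrable (fun ω => piHat (α ω) n) μ := fun n =>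
    h.integrable (dependsBelow_piHat n)
  have hI2 : ∀ n, Integrable (fun ω => (piHat (α ω) n - mainTerm n) ^ 2) μ := fun n =>
    h.integrable ((dependsBelow_piHat n).comp fun x => (x - mainTerm n) ^ 2)
  have hmean : ∀ n, ∫ ω, (piHat (α ω) n - mainTerm n) ∂μ
      = ∫ ω, piHat (α ω) n ∂μ - mainTerm n := by
    intro n
    rw [integral_sub (hI n) (integrable_const _)]
    simp
  have hsq : ∀ n, ∫ ω, piHat (α ω) n ^ 2 ∂μ = ∫ ω, (piHat (α ω) n - mainTerm n) ^ 2 ∂μ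
      + 2 * mainTerm n * ∫ ω, (piHat (α ω) n - mainTerm n) ∂μ + mainTerm n ^ 2 := by
    intro n
    have i1 : Integrable (fun ω => piHat (α ω) n - mainTerm n) μ :=
      (hI n).sub (integrable_const _)
    have e : ∀ ω, piHat (α ω) n ^ 2 = (piHat (α ω) n - mainTerm n) ^ 2
        + 2 * mainTerm n * (piHat (α ω) n - mainTerm n) + mainTerm n ^ 2 := fun ω => by ring
    simp_rw [e]
    rw [integral_add ((hI2 n).fun_add (i1.const_mul _)) (integrable_const _),
      integral_add (hI2 n) (i1.const_mul _), integral_const_mul]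
    simp
  have hT : mainTerm =O[atTop] fun n => (n : ℝ) / Mharm n := by
    refine IsBigO.of_bound 2 (Eventually.of_forall fun n => ?_)
    have hM := one_le_Mharm n
    have h1 : (n : ℝ) / Mharm n ^ 2 ≤ n / Mharm n :=
      div_le_div_of_nonneg_left (by positivity) (by positivity) (by nlinarith)
    rw [Real.norm_of_nonneg (by unfold mainTerm; positivity),
      Real.norm_of_nonneg (by positivity), mainTerm]
    linarith
  refine ⟨?_, ?_⟩
  · have h1 : (fun n => 2 * (mainTerm n * ∫ ω, (piHat (α ω) n - mainTerm n) ∂μ))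
        =O[atTop] fun n : ℕ => (n : ℝ) ^ 2 / Mharm n ^ 4 := by
      refine ((hT.mul h.isBigO_integral_piHat_sub).const_mul_left 2).congr_right fun n => ?_
      rw [div_mul_div_comm]
      ring
    refine ((h.isBigO_integral_piHat_sub_sq.add h1).add
      (isBigO_refl (fun n : ℕ => (n : ℝ) ^ 2 / Mharm n ^ 4) atTop)).congr_left fun n => ?_
    rw [hsq, mainTerm]
    ring
  · refine IsBigO.trans (IsBigO.of_bound 1 (Eventually.of_forall fun n => ?_))
      h.isBigO_integral_piHat_sub_sq
    have e : ∫ ω, piHat (α ω) n ^ 2 ∂μ - (∫ ω, piHat (α ω) n ∂μ) ^ 2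
        = ∫ ω, (piHat (α ω) n - mainTerm n) ^ 2 ∂μ
          - (∫ ω, (piHat (α ω) n - mainTerm n) ∂μ) ^ 2 := by
      rw [hsq, hmean]
      ring
    have hvar : 0 ≤ ∫ ω, piHat (α ω) n ^ 2 ∂μ - (∫ ω, piHat (α ω) n ∂μ) ^ 2 := by
      have hL : MemLp (fun ω => piHat (α ω) n) 2 μ :=
        (memLp_two_iff_integrable_sq (hI n).aestronglyMeasurable).2
          (h.integrable ((dependsBelow_piHat n).comp (· ^ 2)))
      have := ProbabilityTheory.variance_nonneg (fun ω => piHat (α ω) n) μ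
      rwa [ProbabilityTheory.variance_eq_sub hL] at this
    rw [Real.norm_of_nonneg hvar, Real.norm_of_nonneg (integral_nonneg fun ω => sq_nonneg _),
      one_mul, e]
    linarith [sq_nonneg (∫ ω, (piHat (α ω) n - mainTerm n) ∂μ)]
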